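/- Let i+j ≥ n and r = ⌈(i+1)/(n−j)⌉. Then the minimum of β_1+⋯+β_n over all β ∈ ℕA with β_k ≥ 1 for every k ∈ [n] and ⟨β,ν⟩ > 0 equals rn. In particular every such β satisfies β_1+⋯+β_n ≥ rn. (Equivalently, the least degree of a nonzero graded component of the canonical module of K[𝒜] is r, so the a-invariant of K[𝒜] equals −r.) -/

import Mathlib

open Finset in
theorem sum_card_fiber_filter {α β : Type*} [Fintype α] [Fintype β] [DecidableEq β]
    (f : α → β) (p : β → Prop) [DecidablePred p] :
    ∑ m ∈ univ.filter p, (univ.filter (fun k => f k = m)).card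
      = (univ.filter (fun k => p (f k))).card := by
  rw [card_eq_sum_card_fiberwise (f := f) (t := univ.filter p) (fun k hk => by simpa using hk)]
  refine sum_congr rfl fun m hm => ?_
  rw [filter_filter]
  congr 1
  ext k
  simp only [mem_filter, mem_univ, true_and] at hm ⊢
  exact ⟨fun h => ⟨h ▸ hm, h⟩, And.right⟩

theorem sum_card_fiber {α β : Type*} [Fintype α] [Fintype β] [DecidableEq β] (f : α → β) :
    ∑ m, (Finset.univ.filter (fun k => f k = m)).card = Fintype.card α := by
  simpa using sum_card_fiber_filter f (fun _ => True)

theorem card_filter_fin_Ico {n a b : ℕ} (hb : b ≤ n) :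
    (Finset.univ.filter (fun k : Fin n => a ≤ k.val ∧ k.val < b)).card = b - a := by
  rw [← Nat.card_Ico a b]
  refine Finset.card_bij (fun k _ => k.val) (by simp) (fun _ _ _ _ => Fin.ext) fun m hm => ?_
  rw [Finset.mem_Ico] at hm
  exact ⟨⟨m, by omega⟩, by simpa using hm, rfl⟩

/-- A choice function avoiding the low vertices outside the `n - j` unrestricted positions
takes low values at most `n - j` times. -/
theorem card_low_values_le {n i j : ℕ} (hi : i ≤ n) (hj : j ≤ n) (f : Fin n → Fin n)
    (hf : ∀ k : Fin n, (k.val + n < i + j ∨ i ≤ k.val) → i ≤ (f k).val) :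
    (Finset.univ.filter (fun k => (f k).val < i)).card ≤ n - j := by
  calc _ ≤ (Finset.univ.filter (fun k : Fin n => i + j - n ≤ k.val ∧ k.val < i)).card := by
        refine Finset.card_le_card fun k hk => ?_
        simp only [Finset.mem_filter, Finset.mem_univ, true_and] at hk ⊢
        have := hf k
        omega
    _ = i - (i + j - n) := card_filter_fin_Ico hi
    _ ≤ n - j := by omega

/-- The `s`-th choice function of a decomposition of an interior lattice point: the unrestricted
positions of all choice functions together enumerate the low vertices once, and each high position
chooses itself. -/
def interiorChoice (n i j s : ℕ) (hn : 0 < n) (k : Fin n) : Fin n :=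
  if i ≤ k.val then k
  else if h : i + j ≤ k.val + n ∧ s * (n - j) + (k.val + n - (i + j)) < i ∧ i ≤ n then
    ⟨s * (n - j) + (k.val + n - (i + j)), by omega⟩
  else ⟨n - 1, by omega⟩

theorem interiorChoice_high {n i j s : ℕ} (hn : 0 < n) {k : Fin n} (hk : i ≤ k.val) :
    interiorChoice n i j s hn k = k := by
  simp [interiorChoice, hk]

theorem interiorChoice_restricted {n i j s : ℕ} (hn : 0 < n) (hi : i < n) (k : Fin n)
    (hk : k.val + n < i + j ∨ i ≤ k.val) : i ≤ (interiorChoice n i j s hn k).val := by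
  unfold interiorChoice
  split_ifs <;> (try simp only) <;> omega

theorem exists_interiorChoice_eq {n i j r : ℕ} (hn : 0 < n) (hi : i ≤ n) (hj : j < n)
    (hij : n ≤ i + j) (hr : i < r * (n - j)) (m : Fin n) :
    ∃ s < r, ∃ k, interiorChoice n i j s hn k = m := by
  by_cases hm : i ≤ m.val
  · exact ⟨0, Nat.pos_of_ne_zero (by rintro rfl; omega), m, interiorChoice_high hn hm⟩
  · have hmod := Nat.mod_lt m.val (show 0 < n - j by omega)
    have hdiv := Nat.div_add_mod' m.val (n - j)
    refine ⟨m.val / (n - j), (Nat.div_lt_iff_lt_mul (by omega)).2 (by omega),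
      ⟨m.val % (n - j) + (i + j - n), by omega⟩, ?_⟩
    have hsub : m.val % (n - j) + (i + j - n) + n - (i + j) = m.val % (n - j) := by omega
    rw [interiorChoice, if_neg (by simp only; omega),
      dif_pos ⟨by simp only; omega, by simp only [hsub]; omega, hi⟩]
    apply Fin.ext
    simp only [hsub]
    omega

theorem card_low_values_interiorChoice_lt {n i j s : ℕ} (hn : 0 < n) (hi1 : 1 ≤ i) (hi : i < n)
    (hj : j < n) (hij : n ≤ i + j) (hs : i < (s + 1) * (n - j)) :
    (Finset.univ.filter (fun k => (interiorChoice n i j s hn k).val < i)).card < n - j := by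
  rw [add_mul, one_mul] at hs
  calc _ ≤ (Finset.univ.filter
          (fun k : Fin n => i + j - n ≤ k.val ∧ k.val < i - 1)).card := by
        refine Finset.card_le_card fun k hk => ?_
        simp only [Finset.mem_filter, Finset.mem_univ, true_and] at hk ⊢
        unfold interiorChoice at hk
        split_ifs at hk <;> (try simp only at hk) <;> omega
    _ = i - 1 - (i + j - n) := card_filter_fin_Ico (by omega)
    _ < n - j := by omega

theorem sum_filter_lt_add_sum_filter_le {n : ℕ} (i : ℕ) (β : Fin n → ℕ) :
    ∑ k ∈ Finset.univ.filter (fun k : Fin n => k.val < i), β k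
      + ∑ k ∈ Finset.univ.filter (fun k : Fin n => i ≤ k.val), β k = ∑ k, β k := by
  simpa only [not_lt] using
    Finset.sum_filter_add_sum_filter_not Finset.univ (fun k : Fin n => k.val < i) β

/-- On vectors of coordinate sum `d * n`, positivity of the functional `ν` bounds the low part. -/
theorem facet_functional_pos_iff {n i j d : ℕ} (hn : 0 < n) (hj : j ≤ n) (β : Fin n → ℕ)
    (hβ : ∑ k, β k = d * n) :
    0 < -(j : ℤ) * (∑ k ∈ Finset.univ.filter (fun k : Fin n => k.val < i), (β k : ℤ))
        + ((n : ℤ) - j) * (∑ k ∈ Finset.univ.filter (fun k : Fin n => i ≤ k.val), (β k : ℤ)) ↔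
      ∑ k ∈ Finset.univ.filter (fun k : Fin n => k.val < i), β k < d * (n - j) := by
  have hsum := sum_filter_lt_add_sum_filter_le i β
  rw [hβ] at hsum
  rw [← Nat.cast_sum, ← Nat.cast_sum]
  generalize ∑ k ∈ Finset.univ.filter (fun k : Fin n => k.val < i), β k = L at hsum ⊢
  generalize ∑ k ∈ Finset.univ.filter (fun k : Fin n => i ≤ k.val), β k = H at hsum ⊢
  zify [hj] at hsum ⊢
  have heq : -(j : ℤ) * L + (n - j) * H = n * (d * (n - j) - L) := by
    linear_combination ((n : ℤ) - j) * hsum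
  rw [heq, mul_pos_iff_of_pos_left (by exact_mod_cast hn), sub_pos]

/-- a-invariant, case `i + j ≥ n`: with `r = ⌈(i+1)/(n-j)⌉`, the
minimum of `β_1+⋯+β_n` over all `β ∈ ℕA` with `β_k ≥ 1` for all `k` and
`⟨β,ν⟩ > 0` equals `rn` (in particular every such `β` has coordinate sum `≥ rn`);
equivalently, the least degree of a nonzero graded component of the canonical
module of `K[𝒜]` is `r`, so `a(K[𝒜]) = -r`. -/
theorem min_degree_canonical_module_of_le_add
    (n i j r : ℕ) (hn : 3 ≤ n) (hi1 : 1 ≤ i) (hi2 : i ≤ n - 2)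
    (hj1 : 1 ≤ j) (hj2 : j ≤ n - 1) (hij : n ≤ i + j)
    (hr : (r : ℤ) = Int.ceil (((i : ℚ) + 1) / ((n : ℚ) - (j : ℚ))))
    (A : Set (Fin n → ℕ))
    (hA : A = { x | ∃ f : Fin n → Fin n,
        (∀ k : Fin n, (k.val + n < i + j ∨ i ≤ k.val) → i ≤ (f k).val) ∧
        ∀ m : Fin n, x m = (Finset.univ.filter (fun k => f k = m)).card }) :
    IsLeast { d : ℕ | ∃ β : Fin n → ℕ, β ∈ AddSubmonoid.closure A ∧ (∀ k, 1 ≤ β k) ∧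
        0 < -(j : ℤ) * (∑ k ∈ Finset.univ.filter (fun k : Fin n => k.val < i), (β k : ℤ))
            + ((n : ℤ) - j) * (∑ k ∈ Finset.univ.filter (fun k : Fin n => i ≤ k.val), (β k : ℤ)) ∧
        (∑ k, β k) = d } (r * n) := by
  have hceil (d : ℕ) : r ≤ d ↔ i < d * (n - j) := by
    have hpos : (0 : ℚ) < (n : ℚ) - j := by
      rw [sub_pos]
      exact_mod_cast (by omega : j < n)
    rw [← Nat.cast_le (α := ℤ), hr, Int.ceil_le, div_le_iff₀ hpos, Int.cast_natCast,
      ← Nat.cast_sub (by omega : j ≤ n), ← Nat.succ_le_iff]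
    norm_cast
  subst hA
  have hr' : i < r * (n - j) := (hceil r).1 le_rfl
  constructor
  · have hn0 : 0 < n := by omega
    let x (s : ℕ) (m : Fin n) : ℕ :=
      (Finset.univ.filter (fun k => interiorChoice n i j s hn0 k = m)).card
    have hsum : ∑ m, (∑ s ∈ Finset.range r, x s) m = r * n := by
      simp only [Finset.sum_apply]
      rw [Finset.sum_comm]
      simp [x, sum_card_fiber]
    refine ⟨∑ s ∈ Finset.range r, x s, sum_mem fun s _ => AddSubmonoid.subset_closure
      ⟨_, interiorChoice_restricted hn0 (by omega), fun _ => rfl⟩, fun m => ?_, ?_, hsum⟩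
    · obtain ⟨s, hs, k, hk⟩ :=
        exists_interiorChoice_eq hn0 (by omega : i ≤ n) (by omega) hij hr' m
      rw [Finset.sum_apply]
      refine le_trans ?_ (Finset.single_le_sum (f := fun s => x s m) (fun _ _ => Nat.zero_le _)
        (Finset.mem_range.2 hs))
      exact Finset.card_pos.2 ⟨k, by simpa using hk⟩
    · rw [facet_functional_pos_iff hn0 (by omega) _ hsum]
      simp only [Finset.sum_apply]
      rw [Finset.sum_comm]
      simp only [x, sum_card_fiber_filter _ (fun m : Fin n => m.val < i)]
      obtain ⟨q, rfl⟩ : ∃ q, r = q + 1 :=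
        Nat.exists_eq_succ_of_ne_zero (by rintro rfl; omega)
      refine lt_of_lt_of_eq (Finset.sum_lt_sum (g := fun _ => n - j)
        (fun s _ => card_low_values_le (by omega) (by omega) _
          (interiorChoice_restricted hn0 (by omega)))
        ⟨q, by simp, card_low_values_interiorChoice_lt hn0 hi1 (by omega) (by omega) hij hr'⟩)
        (by simp)
  · rintro _ ⟨β, hβ, hβ1, hν, rfl⟩
    obtain ⟨d, hd⟩ : n ∣ ∑ k, β k := by
      clear hβ1 hν
      induction hβ using AddSubmonoid.closure_induction with
      | mem x hx =>
        obtain ⟨f, -, hf⟩ := hx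
        simp [hf, sum_card_fiber]
      | zero => simp
      | add x y _ _ hx hy =>
        simpa [Finset.sum_add_distrib] using dvd_add hx hy
    rw [mul_comm] at hd
    rw [facet_functional_pos_iff (by omega) (by omega) β hd] at hν
    rw [hd]
    refine Nat.mul_le_mul_right n ((hceil d).2 (lt_of_le_of_lt ?_ hν))
    calc i = (Finset.univ.filter (fun k : Fin n => k.val < i)).card := by
          simpa using (card_filter_fin_Ico (a := 0) (by omega : i ≤ n)).symm
      _ ≤ _ := by
          rw [Finset.card_eq_sum_ones]
          exact Finset.sum_le_sum fun k _ => hβ1 k
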